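/- There exist real constants A > 0 and ε > 0 such that for every function k : ℕ → ℕ satisfying k(n) ≤ n for all n and lim_{n→∞} ( n²/4 − ε·n + A·√n − k(n)·(n − k(n)) ) = −∞ (condition (⋆)), the number N^S_{k(n),n} of permutation equivalence classes of k(n)-dimensional linear codes in F_q^n satisfies N^S_{k(n),n} ∼ binom(n, k(n))_q / n! as n → ∞. -/

import Mathlib

open Filter Matrix
open scoped Topology

/-- The `q`-binomial coefficient `binom(n,k)_q = ∏_{j=0}^{k-1} (q^{n-j}-1)/(q^{k-j}-1)`. -/
noncomputable def qBinom (q n k : ℕ) : ℝ :=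
  ∏ j ∈ Finset.range k, ((q : ℝ) ^ (n - j) - 1) / ((q : ℝ) ^ (k - j) - 1)

/-- `S(n) = ∑_{k=0}^n binom(n,k)_q`. -/
noncomputable def Sq (q n : ℕ) : ℝ := ∑ k ∈ Finset.range (n + 1), qBinom q n k

/-- `K_q = ∏_{j=1}^∞ (1 - q^{-j})`. -/
noncomputable def Kq (q : ℕ) : ℝ := ∏' j : ℕ, (1 - ((q : ℝ))⁻¹ ^ (j + 1))

/-- `K_q(k) = ∏_{j=1}^{k} (1 - q^{-j})`. -/
noncomputable def KqTrunc (q k : ℕ) : ℝ := ∏ j ∈ Finset.range k, (1 - ((q : ℝ))⁻¹ ^ (j + 1))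

/-- Jacobi theta constant `θ₂(w) = ∑_{k∈ℤ} w^{(k+1/2)²}`. -/
noncomputable def theta2 (w : ℝ) : ℝ := ∑' k : ℤ, w ^ (((k : ℝ) + 1/2) ^ 2)

/-- Jacobi theta constant `θ₃(w) = ∑_{k∈ℤ} w^{k²}`. -/
noncomputable def theta3 (w : ℝ) : ℝ := ∑' k : ℤ, w ^ ((k : ℝ) ^ 2)

/-- Condition (⋆): `n²/4 − ε·n + A·√n − k(n)(n−k(n)) → −∞`. -/
def StarCond (A ε : ℝ) (k : ℕ → ℕ) : Prop :=
  Tendsto (fun n : ℕ =>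
    (n : ℝ) ^ 2 / 4 - ε * n + A * Real.sqrt n - (k n : ℝ) * ((n : ℝ) - (k n : ℝ)))
    atTop atBot

/-- The set of permutation matrices inside `GL n F`. -/
def permSet (F : Type) [Field F] (n : ℕ) : Set (GL (Fin n) F) :=
  {M | ∃ σ : Equiv.Perm (Fin n), (M : Matrix (Fin n) (Fin n) F) = σ.permMatrix F}

/-- The set of invertible diagonal matrices inside `GL n F`. -/
def diagSet (F : Type) [Field F] (n : ℕ) : Set (GL (Fin n) F) :=
  {M | ∃ d : Fin n → F, (M : Matrix (Fin n) (Fin n) F) = Matrix.diagonal d}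

/-- The permutation group: subgroup of `GL n F` formed by the permutation matrices. -/
def PermGroup (F : Type) [Field F] (n : ℕ) : Subgroup (GL (Fin n) F) :=
  Subgroup.closure (permSet F n)

/-- The monomial group: subgroup of `GL n F` generated by permutation and diagonal matrices. -/
def MonomialGroup (F : Type) [Field F] (n : ℕ) : Subgroup (GL (Fin n) F) :=
  Subgroup.closure (permSet F n ∪ diagSet F n)

/-- Number of orbits of a subgroup `G ≤ GL n F` acting on the Grassmannian of
`k`-dimensional subspaces of `F^n` (by taking images of subspaces). -/
noncomputable def numClassesDim {n : ℕ} (F : Type) [Field F]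
    (G : Subgroup (GL (Fin n) F)) (k : ℕ) : ℕ :=
  Nat.card (Quot (fun V W : {V : Submodule F (Fin n → F) // Module.finrank F V = k} =>
    ∃ M ∈ G, Submodule.map (Matrix.toLin' (M : Matrix (Fin n) (Fin n) F)) V.1 = W.1))

/-- Number of orbits of a subgroup `G ≤ GL n F` acting on the set of all subspaces of `F^n`. -/
noncomputable def numClasses {n : ℕ} (F : Type) [Field F]
    (G : Subgroup (GL (Fin n) F)) : ℕ :=
  Nat.card (Quot (fun V W : Submodule F (Fin n → F) =>
    ∃ M ∈ G, Submodule.map (Matrix.toLin' (M : Matrix (Fin n) (Fin n) F)) V = W))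

/-- Semilinear orbit relation: `W` is the image of `V` under the semilinear transformation
given by applying the field automorphism `σ` componentwise followed by a monomial matrix. -/
def semiRel (F : Type) [Field F] (n : ℕ) (V W : Submodule F (Fin n → F)) : Prop :=
  ∃ σ : F ≃+* F, ∃ M ∈ MonomialGroup F n,
    (W : Set (Fin n → F)) =
      (fun x => Matrix.mulVec (M : Matrix (Fin n) (Fin n) F) (fun i => σ (x i))) '' (V : Set (Fin n → F))

/-- Number of semilinear equivalence classes of `k`-dimensional subspaces of `F^n`. -/
noncomputable def numClassesDimSemi (F : Type) [Field F] (n k : ℕ) : ℕ :=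
  Nat.card (Quot (fun V W : {V : Submodule F (Fin n → F) // Module.finrank F V = k} =>
    semiRel F n V.1 W.1))

/-- Number of semilinear equivalence classes of subspaces of `F^n`. -/
noncomputable def numClassesSemi (F : Type) [Field F] (n : ℕ) : ℕ :=
  Nat.card (Quot (fun V W : Submodule F (Fin n → F) => semiRel F n V W))

open Module in
/-- Counting bases: every `k`-dimensional subspace has as many ordered bases as `F ^ k`. -/
lemma card_grassmannian_mul {F E : Type} [Field F] [Fintype F] [AddCommGroup E] [Module F E]
    [Finite E] (k : ℕ) :
    Nat.card {V : Submodule F E // finrank F V = k} *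
        Nat.card {s : Fin k → (Fin k → F) // LinearIndependent F s} =
      Nat.card {s : Fin k → E // LinearIndependent F s} := by
  have e : {s : Fin k → E // LinearIndependent F s} ≃
      (Σ V : {V : Submodule F E // finrank F V = k},
        {s : Fin k → V.1 // LinearIndependent F s}) :=
    { toFun := fun s => ⟨⟨Submodule.span F (Set.range s.1), by
          simpa using finrank_span_eq_card s.2⟩,
        ⟨fun i => ⟨s.1 i, Submodule.subset_span ⟨i, rfl⟩⟩,
          LinearIndependent.of_comp (Submodule.subtype _) s.2⟩⟩
      invFun := fun p => ⟨fun i => (p.2.1 i : E),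
        p.2.2.map' (Submodule.subtype _) (Submodule.ker_subtype _)⟩
      left_inv := fun s => rfl
      right_inv := by
        rintro ⟨⟨V, hV⟩, s, hs⟩
        have h : Submodule.span F (Set.range fun i => (s i : E)) = V := by
          have h1 := hs.map' V.subtype (Submodule.ker_subtype _)
          apply Submodule.eq_of_le_of_finrank_eq
          · rw [Submodule.span_le]
            rintro _ ⟨i, rfl⟩
            exact (s i).2
          · rw [hV]
            exact (finrank_span_eq_card h1).trans (by simp)
        have aux (W : Submodule F E) (hW : finrank F W = k) (e : V = W) (hm : ∀ i, (s i : E) ∈ W)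
            (hi : LinearIndependent F fun i => (⟨s i, hm i⟩ : W)) :
            (⟨⟨W, hW⟩, ⟨fun i => ⟨s i, hm i⟩, hi⟩⟩ : Σ V : {V : Submodule F E // finrank F V = k},
              {s : Fin k → V.1 // LinearIndependent F s}) = ⟨⟨V, hV⟩, s, hs⟩ := by
          subst e
          rfl
        exact aux _ _ h.symm _ _ }
  have := Fintype.ofFinite {V : Submodule F E // finrank F V = k}
  rw [Nat.card_congr e, Nat.card_sigma]
  have (V : {V : Submodule F E // finrank F V = k}) :
      Nat.card {s : Fin k → V.1 // LinearIndependent F s} =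
        Nat.card {s : Fin k → (Fin k → F) // LinearIndependent F s} := by
    rw [card_linearIndependent V.2.ge, card_linearIndependent (by simp), V.2]
    simp
  simp [this]

open Module in
/-- The Grassmannian is counted by the `q`-binomial coefficient. -/
lemma card_grassmannian {F E : Type} [Field F] [Fintype F] [AddCommGroup E] [Module F E]
    [Finite E] {k : ℕ} (hk : k ≤ finrank F E) :
    (Nat.card {V : Submodule F E // finrank F V = k} : ℝ) =
      qBinom (Fintype.card F) (finrank F E) k := by
  have hq : 1 < Fintype.card F := Fintype.one_lt_card
  have hq' : (1 : ℝ) < Fintype.card F := by exact_mod_cast hq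
  have key (m : ℕ) (hm : k ≤ m) :
      ((∏ i : Fin k, (Fintype.card F ^ m - Fintype.card F ^ (i : ℕ)) : ℕ) : ℝ) =
        ∏ j ∈ Finset.range k,
          (Fintype.card F : ℝ) ^ j * ((Fintype.card F : ℝ) ^ (m - j) - 1) := by
    rw [Finset.prod_range, Nat.cast_prod]
    refine Finset.prod_congr rfl fun i _ => ?_
    rw [Nat.cast_sub (Nat.pow_le_pow_right hq.le (i.2.le.trans hm)), mul_sub, ← pow_add,
      Nat.add_sub_cancel' (i.2.le.trans hm)]
    simp
  have h := card_grassmannian_mul (F := F) (E := E) k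
  rw [card_linearIndependent hk, card_linearIndependent (by simp)] at h
  have h' := congrArg (Nat.cast : ℕ → ℝ) h
  rw [Nat.cast_mul, key _ hk, key _ (by simp)] at h'
  simp only [finrank_fintype_fun_eq_card, Fintype.card_fin, Finset.prod_mul_distrib] at h'
  have h1 : ∏ j ∈ Finset.range k, (Fintype.card F : ℝ) ^ j ≠ 0 :=
    Finset.prod_ne_zero_iff.2 fun j _ => by positivity
  have h2 : ∏ j ∈ Finset.range k, ((Fintype.card F : ℝ) ^ (k - j) - 1) ≠ 0 :=
    Finset.prod_ne_zero_iff.2 fun j hj => by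
      have : k - j ≠ 0 := by have := Finset.mem_range.1 hj; omega
      exact (sub_pos.2 (one_lt_pow₀ hq' this)).ne'
  rw [qBinom, Finset.prod_div_distrib, eq_div_iff h2]
  apply mul_left_cancel₀ h1
  linarith

lemma pow_le_qBinom {q n k : ℕ} (hq : 1 < q) (hk : k ≤ n) :
    (q : ℝ) ^ (k * (n - k)) ≤ qBinom q n k := by
  have hq' : (1 : ℝ) < q := by exact_mod_cast hq
  rw [mul_comm, pow_mul, qBinom]
  calc ((q : ℝ) ^ (n - k)) ^ k = ∏ j ∈ Finset.range k, (q : ℝ) ^ (n - k) := by simp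
    _ ≤ _ := Finset.prod_le_prod (fun _ _ => by positivity) fun j hj => by
      have hj := Finset.mem_range.1 hj
      rw [le_div_iff₀ (sub_pos.2 (one_lt_pow₀ hq' (by omega))), mul_sub, ← pow_add,
        show n - k + (k - j) = n - j by omega]
      linarith [one_le_pow₀ hq'.le (n := n - k)]

lemma quarter_le_prod {x : ℝ} (h0 : 0 ≤ x) (hx : x ≤ 1 / 2) (k : ℕ) :
    1 / 4 ≤ ∏ j ∈ Finset.range k, (1 - x ^ (j + 1)) := by
  have half (k : ℕ) :
      1 / 4 + (1 / 2 : ℝ) ^ (k + 2) ≤ ∏ j ∈ Finset.range (k + 1), (1 - (1 / 2 : ℝ) ^ (j + 1)) := by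
    induction k with
    | zero => norm_num
    | succ k ih =>
      rw [Finset.prod_range_succ]
      have h1 : (1 / 2 : ℝ) ^ (k + 2) ≤ 1 / 4 := by
        rw [pow_add]
        nlinarith [pow_le_one₀ (n := k) (by norm_num : (0 : ℝ) ≤ 1 / 2) (by norm_num)]
      have h2 : (0 : ℝ) < (1 / 2) ^ (k + 2) := by positivity
      rw [show k + 1 + 1 = k + 2 from rfl, pow_succ _ (k + 2)]
      nlinarith [mul_le_mul_of_nonneg_right ih (by linarith : (0 : ℝ) ≤ 1 - (1 / 2) ^ (k + 2))]
  have half' : 1 / 4 ≤ ∏ j ∈ Finset.range k, (1 - (1 / 2 : ℝ) ^ (j + 1)) := by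
    cases k with
    | zero => norm_num
    | succ k => exact le_trans (by linarith [pow_pos (by norm_num : (0 : ℝ) < 1 / 2) (k + 2)]) (half k)
  refine half'.trans (Finset.prod_le_prod (fun j _ => ?_) fun j _ => ?_)
  · exact sub_nonneg.2 (pow_le_one₀ (by norm_num) (by norm_num))
  · exact sub_le_sub_left (pow_le_pow_left₀ h0 hx _) _

lemma qBinom_le {q n k : ℕ} (hq : 1 < q) (hk : k ≤ n) :
    qBinom q n k ≤ 4 * (q : ℝ) ^ (k * (n - k)) := by
  have hq' : (1 : ℝ) < q := by exact_mod_cast hq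
  have hq2 : (2 : ℝ) ≤ q := by exact_mod_cast hq
  have h4 := quarter_le_prod (x := (q : ℝ)⁻¹) (by positivity)
    (by rw [one_div]; exact inv_anti₀ (by norm_num) hq2) k
  rw [← Finset.prod_range_reflect] at h4
  have h : qBinom q n k * ∏ j ∈ Finset.range k, (1 - (q : ℝ)⁻¹ ^ (k - 1 - j + 1)) ≤
      (q : ℝ) ^ (k * (n - k)) := by
    rw [mul_comm k, pow_mul, qBinom, ← Finset.prod_mul_distrib]
    calc _ ≤ ∏ j ∈ Finset.range k, (q : ℝ) ^ (n - k) := ?_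
      _ = _ := by simp
    refine Finset.prod_le_prod (fun j hj => ?_) fun j hj => ?_
    · exact mul_nonneg (div_nonneg (sub_nonneg.2 (one_le_pow₀ hq'.le))
        (sub_nonneg.2 (one_le_pow₀ hq'.le)))
        (sub_nonneg.2 (pow_le_one₀ (by positivity) (inv_le_one_of_one_le₀ hq'.le)))
    · have hj := Finset.mem_range.1 hj
      have hp : 0 < (q : ℝ) ^ (k - j) - 1 := sub_pos.2 (one_lt_pow₀ hq' (by omega))
      have hp' : 0 < (q : ℝ) ^ (k - j) := by positivity
      rw [show k - 1 - j + 1 = k - j by omega, inv_pow, div_mul_eq_mul_div, div_le_iff₀ hp,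
        show n - j = n - k + (k - j) by omega, pow_add,
        show 1 - ((q : ℝ) ^ (k - j))⁻¹ = ((q : ℝ) ^ (k - j) - 1) / (q : ℝ) ^ (k - j) by
          field_simp,
        ← mul_div_assoc, div_le_iff₀ hp']
      nlinarith
  have h0 : 0 ≤ qBinom q n k := le_trans (by positivity) (pow_le_qBinom hq hk)
  nlinarith [mul_le_mul_of_nonneg_left h4 h0]

open Module in
/-- A crude bound on the number of all subspaces. -/
lemma card_submodule_le {F E : Type} [Field F] [Fintype F] [AddCommGroup E] [Module F E]
    [Finite E] :
    (Nat.card (Submodule F E) : ℝ) ≤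
      4 * (finrank F E + 1) * (Fintype.card F : ℝ) ^ ((finrank F E : ℝ) ^ 2 / 4) := by
  have hq : 1 < Fintype.card F := Fintype.one_lt_card
  have hq' : (1 : ℝ) < Fintype.card F := by exact_mod_cast hq
  set d := finrank F E with hd
  have e : Submodule F E ≃ (Σ k : Fin (d + 1), {V : Submodule F E // finrank F V = k}) :=
    (Equiv.sigmaFiberEquiv fun V : Submodule F E =>
      (⟨finrank F V, Nat.lt_succ_of_le V.finrank_le⟩ : Fin (d + 1))).symm.trans
      (Equiv.sigmaCongrRight fun k => Equiv.subtypeEquivRight fun V => by simp [Fin.ext_iff])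
  rw [Nat.card_congr e, Nat.card_sigma, Nat.cast_sum]
  calc _ ≤ ∑ k : Fin (d + 1), 4 * (Fintype.card F : ℝ) ^ ((d : ℝ) ^ 2 / 4) :=
        Finset.sum_le_sum fun k _ => ?_
    _ = _ := by simp; ring
  have hk : (k : ℕ) ≤ d := Nat.le_of_lt_succ k.2
  rw [card_grassmannian hk]
  refine (qBinom_le hq hk).trans ?_
  rw [← Real.rpow_natCast]
  gcongr
  · exact hq'.le
  · rw [Nat.cast_mul, Nat.cast_sub hk]
    nlinarith [sq_nonneg ((d : ℝ) - 2 * (k : ℕ))]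

open Module in
/-- A `T`-invariant `V` lies between `J = N V` and `N⁻¹ J`, for `N = T - 1`, and the quotient
of the latter two has the dimension of `ker N`. -/
lemma card_invariant_le {F E : Type} [Field F] [Finite F] [AddCommGroup E] [Module F E]
    [Finite E] (N : E →ₗ[F] E) :
    Nat.card {V : Submodule F E // V.map N ≤ V} ≤
      Nat.card (Submodule F (LinearMap.range N)) * Nat.card (Submodule F (LinearMap.ker N)) := by
  have hE : FiniteDimensional F E := Module.Finite.of_finite
  have key (J : Submodule F (LinearMap.range N)) :
      Nat.card {V : {V : Submodule F E // V.map N ≤ V} // V.1.map N.rangeRestrict = J} ≤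
        Nat.card (Submodule F (LinearMap.ker N)) := by
    set J' := J.map (LinearMap.range N).subtype with hJ'
    set P := J'.comap N with hP
    have hJN : J' ≤ LinearMap.range N := by
      rintro _ ⟨x, -, rfl⟩
      exact x.2
    have hV (V : {V : {V : Submodule F E // V.map N ≤ V} // V.1.map N.rangeRestrict = J}) :
        J' ≤ V.1.1 ∧ V.1.1 ≤ P := by
      have h : J' = V.1.1.map N := by
        refine (congrArg (Submodule.map (LinearMap.range N).subtype) V.2.symm).trans ?_
        rw [← Submodule.map_comp]
        rfl
      rw [hP, h]
      exact ⟨V.1.2, Submodule.le_comap_map _ _⟩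
    rcases isEmpty_or_nonempty
      {V : {V : Submodule F E // V.map N ≤ V} // V.1.map N.rangeRestrict = J} with h0 | ⟨⟨V0⟩⟩
    · simp
    have hJP : J' ≤ P := (hV V0).1.trans (hV V0).2
    have hker : LinearMap.ker N ≤ P := fun x hx => by
      rw [hP, Submodule.mem_comap, LinearMap.mem_ker.1 hx]
      exact zero_mem _
    have hrange : LinearMap.range (N.domRestrict P) = J' := by
      rw [LinearMap.range_domRestrict, hP, Submodule.map_comap_eq_of_le hJN]
    have h1 := LinearMap.finrank_range_add_finrank_ker (N.domRestrict P)
    rw [hrange, LinearMap.ker_domRestrict,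
      (Submodule.comapSubtypeEquivOfLe hker).finrank_eq] at h1
    have h2 := Submodule.finrank_quotient_add_finrank (J'.comap P.subtype)
    rw [(Submodule.comapSubtypeEquivOfLe hJP).finrank_eq] at h2
    have e : (P ⧸ J'.comap P.subtype) ≃ₗ[F] LinearMap.ker N :=
      LinearEquiv.ofFinrankEq _ _ (by omega)
    have : Finite (P ⧸ J'.comap P.subtype) := Finite.of_surjective _ (Submodule.mkQ_surjective _)
    rw [← Nat.card_congr (Submodule.orderIsoMapComap e).toEquiv]
    refine Nat.card_le_card_of_injective
      (fun V => (V.1.1.comap P.subtype).map (J'.comap P.subtype).mkQ) fun V W h => ?_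
    have h3 := congrArg (Submodule.comap (J'.comap P.subtype).mkQ) h
    simp only [Submodule.comap_map_mkQ] at h3
    rw [sup_eq_right.2 (Submodule.comap_mono (hV V).1),
      sup_eq_right.2 (Submodule.comap_mono (hV W).1)] at h3
    have h4 := congrArg (Submodule.map P.subtype) h3
    simp only [Submodule.map_comap_subtype] at h4
    rw [inf_eq_right.2 (hV V).2, inf_eq_right.2 (hV W).2] at h4
    exact Subtype.ext (Subtype.ext h4)
  have := Fintype.ofFinite (Submodule F (LinearMap.range N))
  rw [Nat.card_congr (Equiv.sigmaFiberEquiv fun V : {V : Submodule F E // V.map N ≤ V} =>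
    V.1.map N.rangeRestrict).symm, Nat.card_sigma]
  refine (Finset.sum_le_sum fun J _ => key J).trans ?_
  simp

open Module in
/-- Over a principal ideal domain, submodules of a module with `c` generators have at most `c`
generators. -/
lemma card_submodule_le_of_span {R M : Type*} [CommRing R] [IsDomain R] [IsPrincipalIdealRing R]
    [AddCommGroup M] [Module R M] [Finite M] {ι : Type*} [Finite ι] (v : ι → M)
    (hv : Submodule.span R (Set.range v) = ⊤) :
    Nat.card (Submodule R M) ≤ Nat.card M ^ Nat.card ι := by
  have := Fintype.ofFinite ι
  rw [← Nat.card_fun]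
  refine Nat.card_le_card_of_surjective
    (fun g : ι → M => Submodule.span R (Set.range g)) fun V => ?_
  have hsurj : Function.Surjective (Fintype.linearCombination R v) := by
    rw [← LinearMap.range_eq_top, Fintype.range_linearCombination, hv]
  obtain ⟨n, b⟩ := Submodule.smithNormalForm (Pi.basisFun R ι)
    (V.comap (Fintype.linearCombination R v))
  have hV : V = Submodule.span R (Set.range fun i => Fintype.linearCombination R v (b.bN i)) := by
    have h1 : (⊤ : Submodule R (V.comap (Fintype.linearCombination R v))).map
        (Submodule.subtype _) = V.comap (Fintype.linearCombination R v) := by simp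
    conv_lhs => rw [← Submodule.map_comap_eq_of_surjective hsurj V, ← h1, ← b.bN.span_eq]
    rw [Submodule.map_span, Submodule.map_span, ← Set.range_comp, ← Set.range_comp]
    rfl
  refine ⟨Function.extend b.f (fun i => Fintype.linearCombination R v (b.bN i)) 0, ?_⟩
  refine Eq.trans ?_ hV.symm
  apply le_antisymm
  · rw [Submodule.span_le]
    rintro _ ⟨j, rfl⟩
    by_cases hj : ∃ i, b.f i = j
    · obtain ⟨i, rfl⟩ := hj
      rw [b.f.injective.extend_apply]
      exact Submodule.subset_span ⟨i, rfl⟩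
    · rw [Function.extend_apply' _ _ _ hj]
      exact zero_mem _
  · refine Submodule.span_mono ?_
    rintro _ ⟨i, rfl⟩
    exact ⟨b.f i, b.f.injective.extend_apply _ _ _⟩

/-- The linear map permuting coordinates. -/
noncomputable abbrev permMap (F : Type) [Field F] {n : ℕ} (σ : Equiv.Perm (Fin n)) :
    (Fin n → F) →ₗ[F] (Fin n → F) := LinearMap.funLeft F F σ

/-- The set of cycles of a permutation, fixed points included. -/
abbrev Cycles {n : ℕ} (σ : Equiv.Perm (Fin n)) : Type :=
  Quotient (Equiv.Perm.SameCycle.setoid σ)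

open Polynomial in
lemma span_cycles (F : Type) [Field F] {n : ℕ} (σ : Equiv.Perm (Fin n)) :
    Submodule.span F[X] (Set.range fun c : Cycles σ =>
      Module.AEval'.of (permMap F σ) (Pi.single c.out 1)) = ⊤ := by
  set S := Submodule.span F[X] (Set.range fun c : Cycles σ =>
      Module.AEval'.of (permMap F σ) (Pi.single c.out 1)) with hS
  have step (i : Fin n) (j : ℕ) (h : Module.AEval'.of (permMap F σ) (Pi.single i 1) ∈ S) :
      Module.AEval'.of (permMap F σ) (Pi.single ((σ⁻¹ ^ j) i) 1) ∈ S := by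
    induction j with
    | zero => simpa using h
    | succ j ih =>
      have := S.smul_mem (X : F[X]) ih
      rw [Module.AEval'.X_smul_of] at this
      convert this using 2
      ext l
      simp only [LinearMap.funLeft_apply, Pi.single_apply, pow_succ', Equiv.Perm.mul_apply,
        Equiv.Perm.eq_inv_iff_eq]
  have basis (i : Fin n) : Module.AEval'.of (permMap F σ) (Pi.single i 1) ∈ S := by
    have h : σ⁻¹.SameCycle (Quotient.mk (Equiv.Perm.SameCycle.setoid σ) i).out i :=
      Equiv.Perm.sameCycle_inv.2 (Quotient.mk_out (s := Equiv.Perm.SameCycle.setoid σ) i)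
    obtain ⟨j, hj⟩ := h.exists_nat_pow_eq
    rw [← hj]
    exact step _ j (Submodule.subset_span ⟨_, rfl⟩)
  rw [eq_top_iff]
  intro x _
  obtain ⟨y, rfl⟩ := (Module.AEval'.of (permMap F σ)).surjective x
  rw [← Finset.univ_sum_single y, map_sum]
  refine S.sum_mem fun i _ => ?_
  have h : (Pi.single i (y i) : Fin n → F) = y i • Pi.single i 1 := by
    ext j; simp [Pi.single_apply]
  rw [h, map_smul]
  exact (S.restrictScalars F).smul_mem _ (basis i)

open Polynomial in
lemma card_invariant_permMap_le (F : Type) [Field F] [Finite F] {n : ℕ} (σ : Equiv.Perm (Fin n)) :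
    Nat.card {V : Submodule F (Fin n → F) // V ≤ V.comap (permMap F σ)} ≤
      Nat.card F ^ (n * Nat.card (Cycles σ)) := by
  have hfin : Finite (Module.AEval' (permMap F σ)) :=
    Finite.of_equiv _ (Module.AEval'.of (permMap F σ)).toEquiv
  have h := card_submodule_le_of_span _ (span_cycles F σ)
  rw [← Nat.card_congr (Module.AEval'.of (permMap F σ)).toEquiv, Nat.card_fun, ← pow_mul] at h
  rw [Nat.card_congr (Module.AEval.mapSubmodule F (Fin n → F) (permMap F σ)).symm.toEquiv] at h
  rw [Nat.card_fin] at h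
  exact h

/-- The fixed space of a permutation consists of the functions constant on cycles. -/
lemma finrank_ker_permMap_sub_one (F : Type) [Field F] {n : ℕ} (σ : Equiv.Perm (Fin n)) :
    Module.finrank F (LinearMap.ker (permMap F σ - 1)) = Nat.card (Cycles σ) := by
  classical
  have h : LinearMap.ker (permMap F σ - 1) = LinearMap.range
      (LinearMap.funLeft F F (Quotient.mk (Equiv.Perm.SameCycle.setoid σ))) := by
    ext f
    simp only [LinearMap.mem_ker, LinearMap.sub_apply, sub_eq_zero, LinearMap.mem_range]
    constructor
    · intro hf
      have hf' (i : Fin n) : f (σ i) = f i := congrFun hf i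
      refine ⟨Quotient.lift f ?_, rfl⟩
      rintro a _ ⟨j, rfl⟩
      have hz (j : ℤ) (a : Fin n) : f ((σ ^ j) a) = f a := by
        induction j generalizing a with
        | zero => simp
        | succ j ih => rw [_root_.zpow_add_one, Equiv.Perm.mul_apply, ih, hf']
        | pred j ih =>
          rw [_root_.zpow_sub_one, Equiv.Perm.mul_apply, ih, ← hf', ← Equiv.Perm.mul_apply, mul_inv_cancel,
            Equiv.Perm.one_apply]
      exact (hz j a).symm
    · rintro ⟨g, rfl⟩
      ext i
      refine congrArg g (Quotient.sound ?_)
      exact Equiv.Perm.sameCycle_apply_left.2 (Equiv.Perm.SameCycle.refl σ i)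
  rw [h, LinearMap.finrank_range_of_inj
    (LinearMap.funLeft_injective_of_surjective F F _ Quotient.mk_surjective)]
  simp

lemma two_mul_card_cycles_add_le {n : ℕ} (σ : Equiv.Perm (Fin n)) :
    2 * Nat.card (Cycles σ) + σ.support.card ≤ 2 * n := by
  classical
  have := Fintype.ofFinite (Cycles σ)
  have h : ∑ c : Cycles σ, 2 ≤ ∑ c : Cycles σ,
      ∑ i : Fin n with (Quotient.mk (Equiv.Perm.SameCycle.setoid σ) i : Cycles σ) = c,
        (if i ∈ σ.support then 1 else 2) := by
    refine Finset.sum_le_sum fun c _ => ?_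
    induction c using Quotient.inductionOn with | h i => ?_
    by_cases hi : i ∈ σ.support
    · have hsub : ({i, σ i} : Finset (Fin n)) ⊆ Finset.univ.filter fun j =>
          (Quotient.mk (Equiv.Perm.SameCycle.setoid σ) j : Cycles σ) = Quotient.mk _ i := by
        intro j hj
        rw [Finset.mem_filter]
        refine ⟨Finset.mem_univ _, ?_⟩
        rcases Finset.mem_insert.1 hj with rfl | hj
        · rfl
        · rw [Finset.mem_singleton.1 hj]
          exact Quotient.sound
            (Equiv.Perm.sameCycle_apply_left.2 (Equiv.Perm.SameCycle.refl σ i))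
      refine le_trans ?_ (Finset.sum_le_sum_of_subset hsub)
      rw [Finset.sum_pair (Ne.symm (Equiv.Perm.mem_support.1 hi))]
      split_ifs <;> norm_num
    · refine le_trans ?_ (Finset.single_le_sum (a := i) (fun _ _ => Nat.zero_le _) (by simp))
      rw [if_neg hi]
  rw [Finset.sum_fiberwise] at h
  have h2 : ∑ i : Fin n, (if i ∈ σ.support then 1 else 2) + σ.support.card = 2 * n := by
    have h3 : σ.support.card = ∑ i : Fin n, if i ∈ σ.support then 1 else 0 := by
      rw [Finset.sum_boole, Finset.filter_univ_mem, Nat.cast_id]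
    rw [h3, ← Finset.sum_add_distrib, Finset.sum_congr rfl (g := fun _ => 2)]
    · simp [mul_comm]
    · intro i _
      split_ifs <;> rfl
  rw [Nat.card_eq_fintype_card]
  simp only [Finset.sum_const, Finset.card_univ, smul_eq_mul] at h
  omega

lemma card_invariant_permMap_le_rpow (F : Type) [Field F] [Fintype F] {n : ℕ}
    (σ : Equiv.Perm (Fin n)) :
    (Nat.card {V : Submodule F (Fin n → F) // V ≤ V.comap (permMap F σ)} : ℝ) ≤
      16 * (n + 1) ^ 2 *
        (Fintype.card F : ℝ) ^ ((n : ℝ) ^ 2 / 4 - σ.support.card * n / 32) := by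
  have hq : (1 : ℝ) < Fintype.card F := by exact_mod_cast Fintype.one_lt_card (α := F)
  set q : ℝ := ((Fintype.card F : ℕ) : ℝ) with hqdef
  have hm : (σ.support.card : ℝ) ≤ n := by
    exact_mod_cast (Finset.card_le_univ σ.support).trans (by simp)
  have hc : 2 * (Nat.card (Cycles σ) : ℝ) + σ.support.card ≤ 2 * n := by
    exact_mod_cast two_mul_card_cycles_add_le σ
  set m : ℝ := (σ.support.card : ℝ) with hmdef
  set c : ℝ := (Nat.card (Cycles σ) : ℝ) with hcdef
  have hm0 : 0 ≤ m := by positivity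
  have hc0 : 0 ≤ c := by positivity
  have hn0 : (0 : ℝ) ≤ n := by positivity
  rcases le_total c (n / 8) with h | h
  · have h1 : (Nat.card {V : Submodule F (Fin n → F) // V ≤ V.comap (permMap F σ)} : ℝ) ≤
        q ^ ((n : ℝ) * c) := by
      rw [hcdef, ← Nat.cast_mul, Real.rpow_natCast, hqdef, ← Nat.card_eq_fintype_card]
      exact_mod_cast card_invariant_permMap_le F σ
    refine h1.trans ((Real.rpow_le_rpow_of_exponent_le hq.le
      (?_ : _ ≤ (n : ℝ) ^ 2 / 4 - m * n / 32)).trans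
        (le_mul_of_one_le_left (Real.rpow_nonneg (by linarith) _) ?_))
    · nlinarith
    · nlinarith
  · have hker := finrank_ker_permMap_sub_one F σ
    have hrank := LinearMap.finrank_range_add_finrank_ker (permMap F σ - 1)
    rw [hker, Module.finrank_fintype_fun_eq_card, Fintype.card_fin] at hrank
    set r := Module.finrank F (LinearMap.range (permMap F σ - 1))
    have hrank' : (r : ℝ) + c = n := by
      rw [hcdef]
      exact_mod_cast hrank
    have h1 := card_invariant_le (permMap F σ - 1)
    have h2 : Nat.card {V : Submodule F (Fin n → F) // V ≤ V.comap (permMap F σ)} ≤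
        Nat.card {V : Submodule F (Fin n → F) // V.map (permMap F σ - 1) ≤ V} := by
      refine Nat.card_le_card_of_injective (fun V => ⟨V.1, ?_⟩) fun V W h => ?_
      · rintro _ ⟨x, hx, rfl⟩
        exact V.1.sub_mem (V.2 hx) hx
      · have h' := congrArg Subtype.val h
        exact Subtype.ext h'
    have h3 : (Nat.card {V : Submodule F (Fin n → F) // V ≤ V.comap (permMap F σ)} : ℝ) ≤
        Nat.card (Submodule F (LinearMap.range (permMap F σ - 1))) *
          Nat.card (Submodule F (LinearMap.ker (permMap F σ - 1))) := by
      exact_mod_cast h2.trans h1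
    have h4 := card_submodule_le (F := F) (E := LinearMap.range (permMap F σ - 1))
    have h5 := card_submodule_le (F := F) (E := LinearMap.ker (permMap F σ - 1))
    rw [hker] at h5
    have hr0 : (0 : ℝ) ≤ r := by positivity
    calc _ ≤ _ := h3
      _ ≤ (4 * (r + 1) * q ^ ((r : ℝ) ^ 2 / 4)) * (4 * (c + 1) * q ^ (c ^ 2 / 4)) :=
        mul_le_mul h4 h5 (by positivity) (by positivity)
      _ = 16 * ((r + 1) * (c + 1)) * q ^ ((r : ℝ) ^ 2 / 4 + c ^ 2 / 4) := by
        rw [Real.rpow_add (by linarith)]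
        ring
      _ ≤ _ := by
        have e1 : ((r : ℝ) + 1) * (c + 1) ≤ (n + 1) ^ 2 := by
          rw [sq]
          gcongr <;> linarith
        have e2 : (r : ℝ) ^ 2 / 4 + c ^ 2 / 4 ≤ (n : ℝ) ^ 2 / 4 - m * n / 32 := by
          rw [← hrank']
          nlinarith [mul_nonneg hr0 (by linarith : (0 : ℝ) ≤ c - n / 8),
            mul_nonneg hn0 (by linarith : (0 : ℝ) ≤ 2 * r - m)]
        gcongr
        exact hq.le

/-- Permutations acting on the Grassmannian by permuting coordinates. -/
noncomputable abbrev permAction (F : Type) [Field F] (n k : ℕ) :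
    MulAction (Equiv.Perm (Fin n)) {V : Submodule F (Fin n → F) // Module.finrank F V = k} where
  smul σ V := ⟨V.1.map (permMap F σ⁻¹), by
    rw [← (Submodule.equivMapOfInjective (permMap F σ⁻¹)
      (LinearMap.funLeft_injective_of_surjective F F _ σ⁻¹.surjective) V.1).finrank_eq, V.2]⟩
  one_smul V := Subtype.ext (Submodule.map_id V.1)
  mul_smul σ τ V := Subtype.ext <| by
    change V.1.map (permMap F (σ * τ)⁻¹) = (V.1.map (permMap F τ⁻¹)).map (permMap F σ⁻¹)
    rw [← Submodule.map_comp, _root_.mul_inv_rev]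
    rfl

lemma mem_permGroup {F : Type} [Field F] {n : ℕ} {M : GL (Fin n) F} :
    M ∈ PermGroup F n ↔
      ∃ σ : Equiv.Perm (Fin n), (M : Matrix (Fin n) (Fin n) F) = σ.permMatrix F := by
  refine ⟨fun h => ?_, fun h => Subgroup.subset_closure h⟩
  induction h using Subgroup.closure_induction with
  | mem M h => exact h
  | one => exact ⟨1, by simp⟩
  | mul M N _ _ hM hN =>
    obtain ⟨σ, hσ⟩ := hM
    obtain ⟨τ, hτ⟩ := hN
    exact ⟨τ * σ, by rw [Matrix.permMatrix_mul, Units.val_mul, hσ, hτ]⟩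
  | inv M _ hM =>
    obtain ⟨σ, hσ⟩ := hM
    refine ⟨σ⁻¹, Units.inv_eq_of_mul_eq_one_right ?_⟩
    rw [hσ, ← Matrix.permMatrix_mul]
    simp

lemma exists_permGroup_map_eq {F : Type} [Field F] {n : ℕ} (V W : Submodule F (Fin n → F)) :
    (∃ M ∈ PermGroup F n,
      Submodule.map (Matrix.toLin' (M : Matrix (Fin n) (Fin n) F)) V = W) ↔
      ∃ σ : Equiv.Perm (Fin n), V.map (permMap F σ) = W := by
  have key (σ : Equiv.Perm (Fin n)) : Matrix.toLin' (σ.permMatrix F) = permMap F σ :=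
    LinearMap.ext fun v => by
      rw [Matrix.toLin'_apply, Matrix.permMatrix_mulVec]
      rfl
  constructor
  · rintro ⟨M, hM, h⟩
    obtain ⟨σ, hσ⟩ := mem_permGroup.1 hM
    exact ⟨σ, by rw [← h, hσ, key]⟩
  · rintro ⟨σ, h⟩
    have hu : IsUnit (σ.permMatrix F) := by
      rw [Matrix.isUnit_iff_isUnit_det, Matrix.det_permutation]
      exact (Equiv.Perm.sign σ).isUnit.map (Int.castRingHom F)
    refine ⟨hu.unit, mem_permGroup.2 ⟨σ, rfl⟩, ?_⟩
    rw [← h, ← key]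
    rfl

/-- Burnside's lemma for the permutation group on the Grassmannian. -/
lemma numClassesDim_mul_factorial (F : Type) [Field F] [Finite F] (n k : ℕ) :
    numClassesDim F (PermGroup F n) k * n.factorial =
      ∑ σ : Equiv.Perm (Fin n), Nat.card {V : {V : Submodule F (Fin n → F) //
        Module.finrank F V = k} // V.1.map (permMap F σ⁻¹) = V.1} := by
  classical
  let := permAction F n k
  have e : Quot (fun V W : {V : Submodule F (Fin n → F) // Module.finrank F V = k} =>
      ∃ M ∈ PermGroup F n,
        Submodule.map (Matrix.toLin' (M : Matrix (Fin n) (Fin n) F)) V.1 = W.1) ≃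
      MulAction.orbitRel.Quotient (Equiv.Perm (Fin n))
        {V : Submodule F (Fin n → F) // Module.finrank F V = k} := by
    refine Quot.congrRight fun V W => ?_
    rw [exists_permGroup_map_eq]
    refine Iff.trans ?_ (Setoid.comm' (MulAction.orbitRel _ _))
    constructor
    · rintro ⟨σ, h⟩
      exact ⟨σ⁻¹, Subtype.ext (by rw [← h]; rfl)⟩
    · rintro ⟨σ, h⟩
      exact ⟨σ⁻¹, congrArg Subtype.val h⟩
  have := Fintype.ofFinite {V : Submodule F (Fin n → F) // Module.finrank F V = k}
  have := Fintype.ofFinite (MulAction.orbitRel.Quotient (Equiv.Perm (Fin n))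
        {V : Submodule F (Fin n → F) // Module.finrank F V = k})
  have h := MulAction.sum_card_fixedBy_eq_card_orbits_mul_card_group (Equiv.Perm (Fin n))
    {V : Submodule F (Fin n → F) // Module.finrank F V = k}
  rw [Fintype.card_perm, Fintype.card_fin] at h
  rw [numClassesDim, Nat.card_congr e, Nat.card_eq_fintype_card, ← h]
  refine Finset.sum_congr rfl fun σ _ => ?_
  rw [← Nat.card_eq_fintype_card]
  exact Nat.card_congr (Equiv.subtypeEquivRight fun V => Subtype.ext_iff)

/-- Expand `(1 + n y) ^ n` over all self-maps, of which permutations form a part. -/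
lemma sum_pow_card_support_le (n : ℕ) {y : ℝ} (hy : 0 ≤ y) :
    ∑ σ : Equiv.Perm (Fin n), y ^ σ.support.card ≤ (1 + n * y) ^ n := by
  classical
  have h1 (i : Fin n) : ∑ j : Fin n, (if j = i then 1 else y) ≤ 1 + n * y := by
    calc _ ≤ ∑ j : Fin n, ((if j = i then 1 else 0) + y) :=
          Finset.sum_le_sum fun j _ => by split_ifs <;> linarith
      _ = _ := by simp [Finset.sum_add_distrib]
  have h0 (i j : Fin n) : 0 ≤ if j = i then 1 else y := by split_ifs <;> linarith
  calc _ = ∑ σ : Equiv.Perm (Fin n), ∏ i, (if σ i = i then 1 else y) := by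
        refine Finset.sum_congr rfl fun σ _ => ?_
        rw [Finset.prod_ite, Finset.prod_const_one, one_mul, Finset.prod_const]
        rfl
    _ ≤ ∑ f : Fin n → Fin n, ∏ i, (if f i = i then 1 else y) := by
        refine (Finset.sum_map Finset.univ ⟨fun σ : Equiv.Perm (Fin n) => (σ : Fin n → Fin n),
          DFunLike.coe_injective⟩
          fun f : Fin n → Fin n => ∏ i, (if f i = i then 1 else y)).symm.trans_le ?_
        exact Finset.sum_le_sum_of_subset_of_nonneg (Finset.subset_univ _)
          fun f _ _ => Finset.prod_nonneg fun i _ => h0 _ _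
    _ = ∏ i : Fin n, ∑ j : Fin n, (if j = i then 1 else y) := by
        rw [Finset.prod_univ_sum, Fintype.piFinset_univ]
    _ ≤ ∏ i : Fin n, (1 + n * y) :=
        Finset.prod_le_prod (fun i _ => Finset.sum_nonneg fun j _ => h0 _ _) fun i _ => h1 i
    _ = _ := by simp

/-- The non-identity terms in Burnside's lemma are negligible. -/
lemma numClassesDim_div_bounds (F : Type) [Field F] [Fintype F] {n k : ℕ} (hk : k ≤ n)
    (h : (n : ℝ) ^ 2 / 4 - 1 / 64 * n ≤ k * ((n : ℝ) - k)) :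
    1 ≤ (numClassesDim F (PermGroup F n) k : ℝ) /
        (qBinom (Fintype.card F) n k / n.factorial) ∧
      (numClassesDim F (PermGroup F n) k : ℝ) /
          (qBinom (Fintype.card F) n k / n.factorial) ≤
        1 + 16 * (n + 1) ^ 2 *
          ((1 + n * ((Fintype.card F : ℝ) ^ (-1 / 64 : ℝ)) ^ n) ^ n - 1) := by
  have hq1 : 1 < Fintype.card F := Fintype.one_lt_card
  have hq : (1 : ℝ) < Fintype.card F := by exact_mod_cast hq1
  have hB : (0 : ℝ) < qBinom (Fintype.card F) n k :=
    lt_of_lt_of_le (by positivity) (pow_le_qBinom hq1 hk)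
  have hBq : (Fintype.card F : ℝ) ^ ((n : ℝ) ^ 2 / 4 - 1 / 64 * n) ≤
      qBinom (Fintype.card F) n k := by
    refine le_trans ?_ (pow_le_qBinom hq1 hk)
    rw [← Real.rpow_natCast _ (k * (n - k)), Nat.cast_mul, Nat.cast_sub hk]
    exact Real.rpow_le_rpow_of_exponent_le hq.le h
  set q : ℝ := ((Fintype.card F : ℕ) : ℝ) with hqdef
  set y : ℝ := (q ^ (-1 / 64 : ℝ)) ^ n with hy
  have hy0 : 0 ≤ y := by positivity
  have hN := congrArg (Nat.cast : ℕ → ℝ) (numClassesDim_mul_factorial F n k)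
  rw [Nat.cast_mul, Nat.cast_sum, ← Finset.add_sum_erase _ _ (Finset.mem_univ 1)] at hN
  have h1 : (Nat.card {V : {V : Submodule F (Fin n → F) // Module.finrank F V = k} //
      V.1.map (permMap F (1 : Equiv.Perm (Fin n))⁻¹) = V.1} : ℝ) =
      qBinom (Fintype.card F) n k := by
    have := card_grassmannian (F := F) (E := Fin n → F) (k := k) (by simpa using hk)
    rw [Module.finrank_fintype_fun_eq_card, Fintype.card_fin] at this
    rw [← this]
    exact congrArg _ (Nat.card_congr (Equiv.subtypeUnivEquiv fun V => Submodule.map_id V.1))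
  have hterm (σ : Equiv.Perm (Fin n)) (hσ : σ ≠ 1) :
      (Nat.card {V : {V : Submodule F (Fin n → F) // Module.finrank F V = k} //
        V.1.map (permMap F σ⁻¹) = V.1} : ℝ) ≤
        16 * (n + 1) ^ 2 * qBinom (Fintype.card F) n k * y ^ σ.support.card := by
    have hle : Nat.card {V : {V : Submodule F (Fin n → F) // Module.finrank F V = k} //
        V.1.map (permMap F σ⁻¹) = V.1} ≤
        Nat.card {V : Submodule F (Fin n → F) // V ≤ V.comap (permMap F σ⁻¹)} :=
      Nat.card_le_card_of_injective (fun V => ⟨V.1.1, Submodule.map_le_iff_le_comap.1 V.2.le⟩)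
        fun V W h => by
          have h' := congrArg Subtype.val h
          exact Subtype.ext (Subtype.ext h')
    have hb := card_invariant_permMap_le_rpow F σ⁻¹
    rw [Equiv.Perm.support_inv] at hb
    have hs : (1 : ℝ) ≤ σ.support.card := by
      exact_mod_cast Finset.card_pos.2
        (Finset.nonempty_iff_ne_empty.2 (mt Equiv.Perm.support_eq_empty_iff.1 hσ))
    have hyq : y ^ σ.support.card = q ^ (-(σ.support.card * n / 64) : ℝ) := by
      rw [hy, ← Real.rpow_natCast, ← Real.rpow_natCast, ← Real.rpow_mul (by positivity),
        ← Real.rpow_mul (by positivity)]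
      congr 1
      ring
    calc _ ≤ _ := (Nat.cast_le (α := ℝ)).2 hle
      _ ≤ _ := hb
      _ ≤ 16 * (n + 1) ^ 2 * (q ^ ((n : ℝ) ^ 2 / 4 - 1 / 64 * n) * y ^ σ.support.card) := by
        rw [hyq, ← Real.rpow_add (by positivity)]
        gcongr
        · exact hq.le
        · nlinarith [mul_nonneg (sub_nonneg.2 hs) (Nat.cast_nonneg (α := ℝ) n)]
      _ ≤ _ := by
        rw [mul_assoc (16 * ((n : ℝ) + 1) ^ 2)]
        gcongr
  rw [h1] at hN
  set R := ∑ σ ∈ Finset.univ.erase (1 : Equiv.Perm (Fin n)),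
    (Nat.card {V : {V : Submodule F (Fin n → F) // Module.finrank F V = k} //
      V.1.map (permMap F σ⁻¹) = V.1} : ℝ) with hR
  have hR0 : 0 ≤ R := Finset.sum_nonneg fun _ _ => Nat.cast_nonneg _
  have hR1 : R ≤ 16 * (n + 1) ^ 2 * qBinom (Fintype.card F) n k * ((1 + n * y) ^ n - 1) := by
    calc R ≤ ∑ σ ∈ Finset.univ.erase (1 : Equiv.Perm (Fin n)),
          16 * (n + 1) ^ 2 * qBinom (Fintype.card F) n k * y ^ σ.support.card :=
          Finset.sum_le_sum fun σ hσ => hterm σ (Finset.ne_of_mem_erase hσ)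
      _ ≤ _ := by
        rw [← Finset.mul_sum]
        have h2 := sum_pow_card_support_le n hy0
        rw [← Finset.add_sum_erase _ _ (Finset.mem_univ 1)] at h2
        simp only [Equiv.Perm.support_one, Finset.card_empty, pow_zero] at h2
        gcongr
        linarith
  rw [div_div_eq_mul_div, hN, add_div, div_self hB.ne']
  refine ⟨le_add_of_nonneg_right (div_nonneg hR0 hB.le), add_le_add_right ?_ 1⟩
  rw [div_le_iff₀ hB]
  linarith

lemma tendsto_error {r : ℝ} (h0 : 0 ≤ r) (h1 : r < 1) :
    Tendsto (fun n : ℕ => 1 + 16 * ((n : ℝ) + 1) ^ 2 * ((1 + n * r ^ n) ^ n - 1))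
      atTop (𝓝 1) := by
  have hlim (j : ℕ) : Tendsto (fun n : ℕ => (n : ℝ) ^ j * r ^ n) atTop (𝓝 0) :=
    tendsto_pow_const_mul_const_pow_of_abs_lt_one j (by rwa [abs_of_nonneg h0])
  have hup : Tendsto (fun n : ℕ => 1 + 32 * ((n : ℝ) ^ 4 * r ^ n + 2 * ((n : ℝ) ^ 3 * r ^ n) +
      (n : ℝ) ^ 2 * r ^ n)) atTop (𝓝 1) := by
    simpa using ((((hlim 4).add ((hlim 3).const_mul 2)).add (hlim 2)).const_mul 32).const_add 1
  refine tendsto_of_tendsto_of_tendsto_of_le_of_le' tendsto_const_nhds hup ?_ ?_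
  · filter_upwards with n
    have : 1 ≤ (1 + n * r ^ n) ^ n := one_le_pow₀ (by simp; positivity)
    have : 0 ≤ 16 * ((n : ℝ) + 1) ^ 2 * ((1 + n * r ^ n) ^ n - 1) :=
      mul_nonneg (by positivity) (by linarith)
    linarith
  · filter_upwards [(hlim 2).eventually (ge_mem_nhds (by norm_num : (0 : ℝ) < 1))] with n hn
    have hexp : (1 + n * r ^ n) ^ n ≤ Real.exp ((n : ℝ) ^ 2 * r ^ n) := by
      calc (1 + n * r ^ n) ^ n ≤ Real.exp (n * r ^ n) ^ n := by
            gcongr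
            linarith [Real.add_one_le_exp (n * r ^ n)]
        _ = _ := by rw [← Real.exp_nat_mul]; ring_nf
    have hp : 0 ≤ (n : ℝ) ^ 2 * r ^ n := by positivity
    have hb := Real.abs_exp_sub_one_le (x := (n : ℝ) ^ 2 * r ^ n) (by rwa [abs_of_nonneg hp])
    rw [abs_of_nonneg hp] at hb
    have hle : (1 + n * r ^ n) ^ n - 1 ≤ 2 * ((n : ℝ) ^ 2 * r ^ n) := by
      linarith [le_abs_self (Real.exp ((n : ℝ) ^ 2 * r ^ n) - 1)]
    have := mul_le_mul_of_nonneg_left hle (by positivity : 0 ≤ 16 * ((n : ℝ) + 1) ^ 2)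
    nlinarith

theorem stmt2 (q : ℕ) (F : Type) [Field F] [Fintype F] (hq : Fintype.card F = q) :
    ∃ A > (0 : ℝ), ∃ ε > (0 : ℝ), ∀ k : ℕ → ℕ, (∀ n, k n ≤ n) → StarCond A ε k →
      Tendsto (fun n : ℕ => (numClassesDim F (PermGroup F n) (k n) : ℝ) /
          (qBinom q n (k n) / (n.factorial : ℝ)))
        atTop (𝓝 1) := by
  subst hq
  refine ⟨1, one_pos, 1 / 64, by norm_num, fun k hk hstar => ?_⟩
  have hq : (1 : ℝ) < Fintype.card F := by exact_mod_cast Fintype.one_lt_card (α := F)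
  have hev : ∀ᶠ n : ℕ in atTop,
      (n : ℝ) ^ 2 / 4 - 1 / 64 * n ≤ k n * ((n : ℝ) - k n) := by
    filter_upwards [hstar.eventually_le_atBot 0] with n hn
    linarith [Real.sqrt_nonneg n]
  refine tendsto_of_tendsto_of_tendsto_of_le_of_le' tendsto_const_nhds
    (tendsto_error (r := (Fintype.card F : ℝ) ^ (-1 / 64 : ℝ)) (by positivity)
      (Real.rpow_lt_one_of_one_lt_of_neg hq (by norm_num))) ?_ ?_
  · filter_upwards [hev] with n hn using (numClassesDim_div_bounds F (hk n) hn).1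
  · filter_upwards [hev] with n hn using (numClassesDim_div_bounds F (hk n) hn).2
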